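/- Let A : ℝ → ℝ be smooth with antiderivative IA (IA′ = A), and suppose the four functions of u given by 1, u, IA(u), u·IA(u) are linearly independent over ℝ. Let F : ℝ⁴ → ℝ, written F = F(t,x,v₁,v₂), and G : ℝ⁵ → ℝ, written G = G(t,x,u,v₁,v₂), be smooth and suppose that for all (t,x,u,p,v₁,v₂) ∈ ℝ⁶: ∂_t F + A(u)·p·(∂_{v₁}F + x·∂_{v₂}F) − IA(u)·∂_{v₂}F + ∂_x G + p·∂_u G + u·(∂_{v₁}G + x·∂_{v₂}G) = 0 (with derivatives of F evaluated at (t,x,v₁,v₂) and of G at (t,x,u,v₁,v₂)). Then there exists a smooth function H : ℝ³ → ℝ, written H = H(t,y,ω), such that for all (t,x,u,v₁,v₂): F(t,x,v₁,v₂) = ∂_y H(t,x,xv₁−v₂) + v₁·∂_ω H(t,x,xv₁−v₂) and G(t,x,u,v₁,v₂) = −∂_t H(t,x,xv₁−v₂) − IA(u)·∂_ω H(t,x,xv₁−v₂). (Hence all potential conservation laws of a diffusion equation u_t = (A(u)u_x)_x with such A are trivial on the manifold of the united potential system v¹_x = u, v¹_t = Au_x, v²_x = xu, v²_t = xAu_x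 − ∫A: F is a total x-derivative and G is minus the corresponding total t-derivative on that manifold.) -/

import Mathlib

/-- Partial derivative of a four-argument function in its first argument. -/
noncomputable def D1 (F : ℝ → ℝ → ℝ → ℝ → ℝ) (t x a b : ℝ) : ℝ :=
  deriv (fun s => F s x a b) t

/-- Partial derivative of a four-argument function in its second argument. -/
noncomputable def D2 (F : ℝ → ℝ → ℝ → ℝ → ℝ) (t x a b : ℝ) : ℝ :=
  deriv (fun s => F t s a b) x

/-- Partial derivative of a four-argument function in its third argument. -/
noncomputable def D3 (F : ℝ → ℝ → ℝ → ℝ → ℝ) (t x a b : ℝ) : ℝ :=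
  deriv (fun s => F t x s b) a

/-- Partial derivative of a four-argument function in its fourth argument. -/
noncomputable def D4 (F : ℝ → ℝ → ℝ → ℝ → ℝ) (t x a b : ℝ) : ℝ :=
  deriv (fun s => F t x a s) b

/-- Partial derivative of a five-argument function in its second argument. -/
noncomputable def E2 (G : ℝ → ℝ → ℝ → ℝ → ℝ → ℝ) (t x w a b : ℝ) : ℝ :=
  deriv (fun s => G t s w a b) x

/-- Partial derivative of a five-argument function in its third argument. -/
noncomputable def E3 (G : ℝ → ℝ → ℝ → ℝ → ℝ → ℝ) (t x w a b : ℝ) : ℝ :=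
  deriv (fun s => G t x s a b) w

/-- Partial derivative of a five-argument function in its fourth argument. -/
noncomputable def E4 (G : ℝ → ℝ → ℝ → ℝ → ℝ → ℝ) (t x w a b : ℝ) : ℝ :=
  deriv (fun s => G t x w s b) a

/-- Partial derivative of a five-argument function in its fifth argument. -/
noncomputable def E5 (G : ℝ → ℝ → ℝ → ℝ → ℝ → ℝ) (t x w a b : ℝ) : ℝ :=
  deriv (fun s => G t x w a s) b

/-- Partial derivative of a three-argument function in its first argument. -/
noncomputable def T1 (H : ℝ → ℝ → ℝ → ℝ) (t y ω : ℝ) : ℝ :=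
  deriv (fun s => H s y ω) t

/-- Partial derivative of a three-argument function in its second argument. -/
noncomputable def T2 (H : ℝ → ℝ → ℝ → ℝ) (t y ω : ℝ) : ℝ :=
  deriv (fun s => H t s ω) y

/-- Partial derivative of a three-argument function in its third argument. -/
noncomputable def T3 (H : ℝ → ℝ → ℝ → ℝ) (t y ω : ℝ) : ℝ :=
  deriv (fun s => H t y s) ω


/-- Smoothness of a curried four-argument function. -/
def Smooth4 (F : ℝ → ℝ → ℝ → ℝ → ℝ) : Prop :=
  ContDiff ℝ (⊤ : ℕ∞) (fun q : ℝ × ℝ × ℝ × ℝ => F q.1 q.2.1 q.2.2.1 q.2.2.2)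

/-- Smoothness of a curried three-argument function. -/
def Smooth3 (F : ℝ → ℝ → ℝ → ℝ) : Prop :=
  ContDiff ℝ (⊤ : ℕ∞) (fun q : ℝ × ℝ × ℝ => F q.1 q.2.1 q.2.2)

lemma Smooth4.partials {F : ℝ → ℝ → ℝ → ℝ → ℝ} (hF : Smooth4 F) (t x a b : ℝ) :
    D1 F t x a b = fderiv ℝ (fun q : ℝ × ℝ × ℝ × ℝ => F q.1 q.2.1 q.2.2.1 q.2.2.2)
      (t, x, a, b) (1, 0, 0, 0) ∧
    D2 F t x a b = fderiv ℝ (fun q : ℝ × ℝ × ℝ × ℝ => F q.1 q.2.1 q.2.2.1 q.2.2.2)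
      (t, x, a, b) (0, 1, 0, 0) ∧
    D3 F t x a b = fderiv ℝ (fun q : ℝ × ℝ × ℝ × ℝ => F q.1 q.2.1 q.2.2.1 q.2.2.2)
      (t, x, a, b) (0, 0, 1, 0) ∧
    D4 F t x a b = fderiv ℝ (fun q : ℝ × ℝ × ℝ × ℝ => F q.1 q.2.1 q.2.2.1 q.2.2.2)
      (t, x, a, b) (0, 0, 0, 1) := by
  have hd := ((ContDiff.differentiable hF (by simp)) (t, x, a, b)).hasFDerivAt
  refine ⟨?_, ?_, ?_, ?_⟩
  · exact (hd.comp_hasDerivAt (f := fun s : ℝ => (s, x, a, b)) t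
      ((hasDerivAt_id t).prodMk ((hasDerivAt_const t x).prodMk
        ((hasDerivAt_const t a).prodMk (hasDerivAt_const t b))))).deriv
  · exact (hd.comp_hasDerivAt (f := fun s : ℝ => (t, s, a, b)) x
      ((hasDerivAt_const x t).prodMk ((hasDerivAt_id x).prodMk
        ((hasDerivAt_const x a).prodMk (hasDerivAt_const x b))))).deriv
  · exact (hd.comp_hasDerivAt (f := fun s : ℝ => (t, x, s, b)) a
      ((hasDerivAt_const a t).prodMk ((hasDerivAt_const a x).prodMk
        ((hasDerivAt_id a).prodMk (hasDerivAt_const a b))))).deriv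
  · exact (hd.comp_hasDerivAt (f := fun s : ℝ => (t, x, a, s)) b
      ((hasDerivAt_const b t).prodMk ((hasDerivAt_const b x).prodMk
        ((hasDerivAt_const b a).prodMk (hasDerivAt_id b))))).deriv

lemma Smooth4.chain {F : ℝ → ℝ → ℝ → ℝ → ℝ} (hF : Smooth4 F) {t x a b : ℝ → ℝ}
    {t' x' a' b' s : ℝ} (ht : HasDerivAt t t' s) (hx : HasDerivAt x x' s)
    (ha : HasDerivAt a a' s) (hb : HasDerivAt b b' s) :
    HasDerivAt (fun s => F (t s) (x s) (a s) (b s))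
      (t' * D1 F (t s) (x s) (a s) (b s) + x' * D2 F (t s) (x s) (a s) (b s)
        + a' * D3 F (t s) (x s) (a s) (b s) + b' * D4 F (t s) (x s) (a s) (b s)) s := by
  have hd := ((ContDiff.differentiable hF (by simp)) (t s, x s, a s, b s)).hasFDerivAt
  have h := hd.comp_hasDerivAt (f := fun s : ℝ => (t s, x s, a s, b s)) s
    (ht.prodMk (hx.prodMk (ha.prodMk hb)))
  obtain ⟨h1, h2, h3, h4⟩ := hF.partials (t s) (x s) (a s) (b s)
  refine h.congr_deriv ?_
  rw [h1, h2, h3, h4]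
  have : ((t', x', a', b') : ℝ × ℝ × ℝ × ℝ) = t' • (1, 0, 0, 0) + x' • (0, 1, 0, 0)
      + a' • (0, 0, 1, 0) + b' • (0, 0, 0, 1) := by simp
  rw [this]
  simp only [map_add, map_smul, smul_eq_mul]

lemma Smooth3.partials {F : ℝ → ℝ → ℝ → ℝ} {t x a : ℝ} {L : ℝ × ℝ × ℝ →L[ℝ] ℝ}
    (hd : HasFDerivAt (fun q : ℝ × ℝ × ℝ => F q.1 q.2.1 q.2.2) L (t, x, a)) :
    T1 F t x a = L (1, 0, 0) ∧ T2 F t x a = L (0, 1, 0) ∧ T3 F t x a = L (0, 0, 1) := by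
  refine ⟨?_, ?_, ?_⟩
  · exact (hd.comp_hasDerivAt (f := fun s : ℝ => (s, x, a)) t
      ((hasDerivAt_id t).prodMk ((hasDerivAt_const t x).prodMk
        (hasDerivAt_const t a)))).deriv
  · exact (hd.comp_hasDerivAt (f := fun s : ℝ => (t, s, a)) x
      ((hasDerivAt_const x t).prodMk ((hasDerivAt_id x).prodMk
        (hasDerivAt_const x a)))).deriv
  · exact (hd.comp_hasDerivAt (f := fun s : ℝ => (t, x, s)) a
      ((hasDerivAt_const a t).prodMk ((hasDerivAt_const a x).prodMk
        (hasDerivAt_id a)))).deriv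

lemma Smooth3.fderiv_apply {F : ℝ → ℝ → ℝ → ℝ} (hF : Smooth3 F) (q v : ℝ × ℝ × ℝ) :
    fderiv ℝ (fun q : ℝ × ℝ × ℝ => F q.1 q.2.1 q.2.2) q v
      = v.1 * T1 F q.1 q.2.1 q.2.2 + v.2.1 * T2 F q.1 q.2.1 q.2.2
        + v.2.2 * T3 F q.1 q.2.1 q.2.2 := by
  obtain ⟨t, x, a⟩ := q
  obtain ⟨t', x', a'⟩ := v
  have hd := ((ContDiff.differentiable hF (by simp)) (t, x, a)).hasFDerivAt
  obtain ⟨h1, h2, h3⟩ := Smooth3.partials hd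
  have : ((t', x', a') : ℝ × ℝ × ℝ) = t' • (1, 0, 0) + x' • (0, 1, 0) + a' • (0, 0, 1) := by simp
  rw [this]
  simp only [map_add, map_smul, smul_eq_mul, ← h1, ← h2, ← h3]
  simp

lemma Smooth3.chain {F : ℝ → ℝ → ℝ → ℝ} (hF : Smooth3 F) {t x a : ℝ → ℝ}
    {t' x' a' s : ℝ} (ht : HasDerivAt t t' s) (hx : HasDerivAt x x' s)
    (ha : HasDerivAt a a' s) :
    HasDerivAt (fun s => F (t s) (x s) (a s))
      (t' * T1 F (t s) (x s) (a s) + x' * T2 F (t s) (x s) (a s)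
        + a' * T3 F (t s) (x s) (a s)) s := by
  have hd := ((ContDiff.differentiable hF (by simp)) (t s, x s, a s)).hasFDerivAt
  have h := hd.comp_hasDerivAt (f := fun s : ℝ => (t s, x s, a s)) s
    (ht.prodMk (hx.prodMk ha))
  exact h.congr_deriv (hF.fderiv_apply _ _)

/-- The Poincare lemma for smooth one-forms on three-space. -/
lemma poincare3 {a b c : ℝ → ℝ → ℝ → ℝ} (ha : Smooth3 a) (hb : Smooth3 b) (hc : Smooth3 c)
    (h12 : ∀ t y w, T2 a t y w = T1 b t y w)
    (h13 : ∀ t y w, T3 a t y w = T1 c t y w)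
    (h23 : ∀ t y w, T3 b t y w = T2 c t y w) :
    ∃ H : ℝ → ℝ → ℝ → ℝ, Smooth3 H ∧ ∀ t y w,
      T1 H t y w = a t y w ∧ T2 H t y w = b t y w ∧ T3 H t y w = c t y w := by
  let e1 : ℝ × ℝ × ℝ →L[ℝ] ℝ := ContinuousLinearMap.fst ℝ ℝ (ℝ × ℝ)
  let e2 : ℝ × ℝ × ℝ →L[ℝ] ℝ :=
    (ContinuousLinearMap.fst ℝ ℝ ℝ).comp (ContinuousLinearMap.snd ℝ ℝ (ℝ × ℝ))
  let e3 : ℝ × ℝ × ℝ →L[ℝ] ℝ :=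
    (ContinuousLinearMap.snd ℝ ℝ ℝ).comp (ContinuousLinearMap.snd ℝ ℝ (ℝ × ℝ))
  let om : ℝ × ℝ × ℝ → (ℝ × ℝ × ℝ →L[ℝ] ℝ) := fun q =>
    a q.1 q.2.1 q.2.2 • e1 + b q.1 q.2.1 q.2.2 • e2 + c q.1 q.2.1 q.2.2 • e3
  have hom : ContDiff ℝ (⊤ : ℕ∞) om :=
    ((ContDiff.smul ha contDiff_const).add (ContDiff.smul hb contDiff_const)).add
      (ContDiff.smul hc contDiff_const)
  have hdiff : ∀ {f : ℝ → ℝ → ℝ → ℝ}, Smooth3 f → ∀ q, HasFDerivAt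
      (fun q : ℝ × ℝ × ℝ => f q.1 q.2.1 q.2.2)
      (fderiv ℝ (fun q : ℝ × ℝ × ℝ => f q.1 q.2.1 q.2.2) q) q := fun hf q =>
    ((ContDiff.differentiable hf (by simp)) q).hasFDerivAt
  have hdom : ∀ q, HasFDerivAt om _ q := fun q =>
    (((hdiff ha q).smul_const e1).add ((hdiff hb q).smul_const e2)).add
      ((hdiff hc q).smul_const e3)
  obtain ⟨f, hf⟩ := (convex_univ (𝕜 := ℝ) (E := ℝ × ℝ × ℝ)).exists_forall_hasFDerivAt_of_fderiv_symmetric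
    isOpen_univ (ω := om) (hom.differentiable (by simp)).differentiableOn (by
      intro q _ x y
      rw [(hdom q).fderiv]
      simp only [add_apply, ContinuousLinearMap.smulRight_apply,
        smul_apply, smul_eq_mul, ha.fderiv_apply, hb.fderiv_apply,
        hc.fderiv_apply, h12, h13, h23]
      simp only [e1, e2, e3, ContinuousLinearMap.comp_apply, ContinuousLinearMap.coe_fst',
        ContinuousLinearMap.coe_snd']
      ring)
  have hf' : ∀ q, HasFDerivAt f (om q) q := fun q => hf q (Set.mem_univ q)
  refine ⟨fun t y w => f (t, y, w), ?_, ?_⟩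
  · have : ContDiff ℝ (⊤ : ℕ∞) f := by
      rw [contDiff_infty_iff_fderiv]
      refine ⟨fun q => (hf' q).differentiableAt, ?_⟩
      have : fderiv ℝ f = om := funext fun q => (hf' q).fderiv
      rw [this]
      exact hom
    exact this
  · intro t y w
    obtain ⟨h1, h2, h3⟩ := Smooth3.partials (F := fun t y w => f (t, y, w)) (hf' (t, y, w))
    rw [h1, h2, h3]
    simp [om, e1, e2, e3]

lemma Smooth4.d3 {F : ℝ → ℝ → ℝ → ℝ → ℝ} (hF : Smooth4 F) : Smooth4 (D3 F) := by
  have : (fun q : ℝ × ℝ × ℝ × ℝ => D3 F q.1 q.2.1 q.2.2.1 q.2.2.2) = fun q =>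
      fderiv ℝ (fun q : ℝ × ℝ × ℝ × ℝ => F q.1 q.2.1 q.2.2.1 q.2.2.2) q (0, 0, 1, 0) :=
    funext fun q => (hF.partials _ _ _ _).2.2.1
  unfold Smooth4
  rw [this]
  exact (ContDiff.fderiv_right hF (by simp)).clm_apply contDiff_const

lemma Smooth4.d4 {F : ℝ → ℝ → ℝ → ℝ → ℝ} (hF : Smooth4 F) : Smooth4 (D4 F) := by
  have : (fun q : ℝ × ℝ × ℝ × ℝ => D4 F q.1 q.2.1 q.2.2.1 q.2.2.2) = fun q =>
      fderiv ℝ (fun q : ℝ × ℝ × ℝ × ℝ => F q.1 q.2.1 q.2.2.1 q.2.2.2) q (0, 0, 0, 1) :=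
    funext fun q => (hF.partials _ _ _ _).2.2.2
  unfold Smooth4
  rw [this]
  exact (ContDiff.fderiv_right hF (by simp)).clm_apply contDiff_const

/-- Restriction to the slice `a = 0`, `b = -w`. -/
def slice (F : ℝ → ℝ → ℝ → ℝ → ℝ) (t y w : ℝ) : ℝ := F t y 0 (-w)

lemma Smooth4.slice {F : ℝ → ℝ → ℝ → ℝ → ℝ} (hF : Smooth4 F) : Smooth3 (slice F) := by
  have h : ContDiff ℝ (⊤ : ℕ∞) (fun q : ℝ × ℝ × ℝ => (q.1, q.2.1, (0 : ℝ), -q.2.2)) := by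
    fun_prop
  exact ContDiff.comp hF h

lemma hasDerivAt_slot1 {F : ℝ → ℝ → ℝ → ℝ → ℝ} (hF : Smooth4 F) (t x a b : ℝ) :
    HasDerivAt (fun s => F s x a b) (D1 F t x a b) t := by
  simpa using hF.chain (hasDerivAt_id t) (hasDerivAt_const t x) (hasDerivAt_const t a)
    (hasDerivAt_const t b)

lemma hasDerivAt_slot2 {F : ℝ → ℝ → ℝ → ℝ → ℝ} (hF : Smooth4 F) (t x a b : ℝ) :
    HasDerivAt (fun s => F t s a b) (D2 F t x a b) x := by
  simpa using hF.chain (hasDerivAt_const x t) (hasDerivAt_id x) (hasDerivAt_const x a)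
    (hasDerivAt_const x b)

lemma hasDerivAt_slot3 {F : ℝ → ℝ → ℝ → ℝ → ℝ} (hF : Smooth4 F) (t x a b : ℝ) :
    HasDerivAt (fun s => F t x s b) (D3 F t x a b) a := by
  simpa using hF.chain (hasDerivAt_const a t) (hasDerivAt_const a x) (hasDerivAt_id a)
    (hasDerivAt_const a b)

lemma hasDerivAt_slot4 {F : ℝ → ℝ → ℝ → ℝ → ℝ} (hF : Smooth4 F) (t x a b : ℝ) :
    HasDerivAt (fun s => F t x a s) (D4 F t x a b) b := by
  simpa using hF.chain (hasDerivAt_const b t) (hasDerivAt_const b x) (hasDerivAt_const b a)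
    (hasDerivAt_id b)

lemma slice_T3 {F : ℝ → ℝ → ℝ → ℝ → ℝ} (hF : Smooth4 F) (t y w : ℝ) :
    T3 (slice F) t y w = - D4 F t y 0 (-w) := by
  have h := hF.chain (hasDerivAt_const w t) (hasDerivAt_const w y) (hasDerivAt_const w 0)
    (hasDerivAt_id w).neg
  have h2 : T3 (slice F) t y w = _ := h.deriv
  rw [h2]
  simp

/-- Solution of the transport equation with a source that is constant along characteristics. -/
lemma transport {F : ℝ → ℝ → ℝ → ℝ → ℝ} (hF : Smooth4 F) {t x c k : ℝ}
    (h : ∀ s, D3 F t x s (c + x * s) + x * D4 F t x s (c + x * s) = k) (a : ℝ) :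
    F t x a (c + x * a) = F t x 0 c + a * k := by
  have hd : ∀ s, HasDerivAt (fun s => F t x s (c + x * s) - s * k) 0 s := by
    intro s
    have h1 := hF.chain (hasDerivAt_const s t) (hasDerivAt_const s x) (hasDerivAt_id s)
      (((hasDerivAt_id s).const_mul x).const_add c)
    have h2 := h1.sub ((hasDerivAt_id s).mul_const k)
    refine h2.congr_deriv ?_
    have := h s
    simp only [id]
    linarith
  have := is_const_of_deriv_eq_zero (fun s => (hd s).differentiableAt) (fun s => (hd s).deriv) a 0
  simp at this
  linarith

/-- All potential conservation laws of a diffusion equation `u_t = (A(u)u_x)_x`, with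
`1, u, ∫A, u∫A` linearly independent, are trivial on the manifold of the united
potential system built from the two independent local conservation laws. -/
theorem potential_conservation_laws_diffusion_trivial
    (A IA : ℝ → ℝ) (hA : ContDiff ℝ (⊤ : ℕ∞) A) (hIA : ∀ w : ℝ, HasDerivAt IA (A w) w)
    (hLI : ∀ c0 c1 c2 c3 : ℝ,
      (∀ w : ℝ, c0 + c1 * w + c2 * IA w + c3 * (w * IA w) = 0) →
        c0 = 0 ∧ c1 = 0 ∧ c2 = 0 ∧ c3 = 0)
    (F : ℝ → ℝ → ℝ → ℝ → ℝ) (G : ℝ → ℝ → ℝ → ℝ → ℝ → ℝ)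
    (hF : ContDiff ℝ (⊤ : ℕ∞) (fun q : ℝ × ℝ × ℝ × ℝ => F q.1 q.2.1 q.2.2.1 q.2.2.2))
    (hG : ContDiff ℝ (⊤ : ℕ∞)
      (fun q : ℝ × ℝ × ℝ × ℝ × ℝ => G q.1 q.2.1 q.2.2.1 q.2.2.2.1 q.2.2.2.2))
    (hdet : ∀ t x u p v1 v2 : ℝ,
      D1 F t x v1 v2
        + A u * p * (D3 F t x v1 v2 + x * D4 F t x v1 v2)
        - IA u * D4 F t x v1 v2
        + E2 G t x u v1 v2 + p * E3 G t x u v1 v2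
        + u * (E4 G t x u v1 v2 + x * E5 G t x u v1 v2) = 0) :
    ∃ H : ℝ → ℝ → ℝ → ℝ,
      ContDiff ℝ (⊤ : ℕ∞) (fun q : ℝ × ℝ × ℝ => H q.1 q.2.1 q.2.2) ∧
      ∀ t x u v1 v2 : ℝ,
        F t x v1 v2
            = T2 H t x (x * v1 - v2) + v1 * T3 H t x (x * v1 - v2) ∧
        G t x u v1 v2
            = - T1 H t x (x * v1 - v2) - IA u * T3 H t x (x * v1 - v2) := by
  have hF4 : Smooth4 F := hF
  -- the operator L applied to F
  let P : ℝ → ℝ → ℝ → ℝ → ℝ := fun t x a b => D3 F t x a b + x * D4 F t x a b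
  have hP : Smooth4 P := by
    have hx : ContDiff ℝ (⊤ : ℕ∞) (fun q : ℝ × ℝ × ℝ × ℝ => q.2.1) := by fun_prop
    exact ContDiff.add hF4.d3 (ContDiff.mul hx hF4.d4)
  let K : ℝ → ℝ → ℝ → ℝ → ℝ := fun t x a b => G t x 0 a b + IA 0 * P t x a b
  have hK : Smooth4 K := by
    have hm : ContDiff ℝ (⊤ : ℕ∞)
        (fun q : ℝ × ℝ × ℝ × ℝ => (q.1, q.2.1, (0 : ℝ), q.2.2.1, q.2.2.2)) := by fun_prop
    exact ContDiff.add (ContDiff.comp hG hm) (ContDiff.mul contDiff_const hP)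
  -- the coefficient of p
  have hE3 : ∀ t x u a b, E3 G t x u a b = - A u * P t x a b := by
    intro t x u a b
    have h0 := hdet t x u 0 a b
    have h1 := hdet t x u 1 a b
    simp only [P]
    linarith
  have hGdiff : ∀ t x u a b, HasDerivAt (fun s => G t x s a b) (E3 G t x u a b) u := by
    intro t x u a b
    have hm : ContDiff ℝ (⊤ : ℕ∞) (fun s : ℝ => (t, x, s, a, b)) := by fun_prop
    exact (((ContDiff.comp hG hm).differentiable (by simp)) u).hasDerivAt
  have hGrep : ∀ t x u a b, G t x u a b = K t x a b - IA u * P t x a b := by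
    intro t x u a b
    have hd : ∀ s, HasDerivAt (fun s => G t x s a b + IA s * P t x a b) 0 s := by
      intro s
      refine ((hGdiff t x s a b).add ((hIA s).mul_const _)).congr_deriv ?_
      rw [hE3]
      ring
    have := is_const_of_deriv_eq_zero (fun s => (hd s).differentiableAt)
      (fun s => (hd s).deriv) u 0
    simp only [K]
    linarith
  have hE2 : ∀ t x u a b, E2 G t x u a b = D2 K t x a b - IA u * D2 P t x a b := by
    intro t x u a b
    unfold E2
    simp only [hGrep]
    exact ((hasDerivAt_slot2 hK t x a b).sub
      ((hasDerivAt_slot2 hP t x a b).const_mul (IA u))).deriv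
  have hE4 : ∀ t x u a b, E4 G t x u a b = D3 K t x a b - IA u * D3 P t x a b := by
    intro t x u a b
    unfold E4
    simp only [hGrep]
    exact ((hasDerivAt_slot3 hK t x a b).sub
      ((hasDerivAt_slot3 hP t x a b).const_mul (IA u))).deriv
  have hE5 : ∀ t x u a b, E5 G t x u a b = D4 K t x a b - IA u * D4 P t x a b := by
    intro t x u a b
    unfold E5
    simp only [hGrep]
    exact ((hasDerivAt_slot4 hK t x a b).sub
      ((hasDerivAt_slot4 hP t x a b).const_mul (IA u))).deriv
  -- splitting with respect to u
  have hsplit : ∀ t x a b, D1 F t x a b + D2 K t x a b = 0 ∧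
      D3 K t x a b + x * D4 K t x a b = 0 ∧
      -(D4 F t x a b + D2 P t x a b) = 0 ∧
      -(D3 P t x a b + x * D4 P t x a b) = 0 := by
    intro t x a b
    apply hLI
    intro u
    have h0 := hdet t x u 0 a b
    rw [hE2, hE4, hE5] at h0
    linear_combination h0
  have hPrep : ∀ t x a b, P t x a b = slice P t x (x * a - b) := by
    intro t x a b
    have h := transport hP (t := t) (x := x) (c := b - x * a) (k := 0)
      (fun s => by linarith [(hsplit t x s (b - x * a + x * s)).2.2.2]) a
    simpa [slice] using h
  have hKrep : ∀ t x a b, K t x a b = slice K t x (x * a - b) := by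
    intro t x a b
    have h := transport hK (t := t) (x := x) (c := b - x * a) (k := 0)
      (fun s => by linarith [(hsplit t x s (b - x * a + x * s)).2.1]) a
    simpa [slice] using h
  have hFrep : ∀ t x a b, F t x a b
      = slice F t x (x * a - b) + a * slice P t x (x * a - b) := by
    intro t x a b
    have h := transport hF4 (t := t) (x := x) (c := b - x * a)
      (k := slice P t x (x * a - b)) (fun s => by
        have h1 := hPrep t x s (b - x * a + x * s)
        rw [show x * s - (b - x * a + x * s) = x * a - b by ring] at h1
        exact h1) a
    simpa [slice] using h
  have hsF := hF4.slice
  have hsP := hP.slice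
  have hsK := hK.slice
  have c1 : ∀ t y w, T1 (slice F) t y w + T2 (slice K) t y w = 0 := fun t y w =>
    (hsplit t y 0 (-w)).1
  have c2 : ∀ t y w, T3 (slice F) t y w = T2 (slice P) t y w := by
    intro t y w
    rw [slice_T3 hF4]
    have h := (hsplit t y 0 (-w)).2.2.1
    have h2 : T2 (slice P) t y w = D2 P t y 0 (-w) := rfl
    linarith
  have c3 : ∀ t y w, T1 (slice P) t y w + T3 (slice K) t y w = 0 := by
    intro t y w
    have h := (hsplit t y 1 (y - w)).1
    have h1 : D1 F t y 1 (y - w) = T1 (slice F) t y w + T1 (slice P) t y w := by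
      unfold D1
      simp only [hFrep]
      have ha := (hsF.chain (hasDerivAt_id t) (hasDerivAt_const t y)
        (hasDerivAt_const t w)).add (hsP.chain (hasDerivAt_id t) (hasDerivAt_const t y)
        (hasDerivAt_const t w))
      have hb : deriv (fun s => slice F s y w + slice P s y w) t = _ := ha.deriv
      simpa using hb
    have h2 : D2 K t y 1 (y - w) = T2 (slice K) t y w + T3 (slice K) t y w := by
      unfold D2
      have hfun : (fun s => K t s 1 (y - w)) = fun s => slice K t s (s - (y - w)) := by
        funext s
        rw [hKrep, mul_one]
      rw [hfun]
      have ha := hsK.chain (hasDerivAt_const y t) (hasDerivAt_id y)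
        ((hasDerivAt_id y).sub_const (y - w))
      have := ha.deriv
      simpa using this
    have := c1 t y w
    linarith
  let N : ℝ → ℝ → ℝ → ℝ := fun t y w => - slice K t y w
  have hN : Smooth3 N := ContDiff.neg hsK
  have hN2 : ∀ t y w, T2 N t y w = - T2 (slice K) t y w := fun t y w => deriv.fun_neg
  have hN3 : ∀ t y w, T3 N t y w = - T3 (slice K) t y w := fun t y w => deriv.fun_neg
  obtain ⟨H, hH, hH'⟩ := poincare3 hN hsF hsP
    (fun t y w => by rw [hN2]; linarith [c1 t y w])
    (fun t y w => by rw [hN3]; linarith [c3 t y w]) c2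
  refine ⟨H, hH, fun t x u v1 v2 => ?_⟩
  obtain ⟨h1, h2, h3⟩ := hH' t x (x * v1 - v2)
  rw [h1, h2, h3]
  refine ⟨hFrep t x v1 v2, ?_⟩
  rw [hGrep, hKrep, hPrep]
  simp only [N]
  ring
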